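/- For every integer n ≥ 1 and every real v > 0, the function φ(s) = −(1/(4π))·[(s/v)·c_n(v,s)·I_n(v,s) + 2πn·c_n(v,s)·(I_n(v,s) − J_n(v,s))], defined for real s > 0, is differentiable at s = 1 and its derivative there equals φ'(1) = e^{2πnv}·σ(n)·( e^{−4πnv}/(4πnv) − ∫₁^∞ e^{−4πnvt}·t^{−1} dt ). (This computes the Fourier coefficient a'(v,1,m) = σ(|m|)·(Ei(−4π|m|v) + e^{−4π|m|v}/(4π|m|v)) of E₂'(τ,1) for negative indices m = −n, where Ei(−x) = −∫₁^∞ e^{−xt} t^{−1} dt.) -/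

import Mathlib

open Real MeasureTheory Set

/-- The generalized divisor sum `σ*_ν(m) = m^ν · Σ_{d∣m} d^{−2ν}`. -/
noncomputable def sigmaStar (m : ℕ) (ν : ℝ) : ℝ :=
  (m : ℝ) ^ ν * ∑ d ∈ m.divisors, (d : ℝ) ^ (-(2 * ν))

/-- The coefficient `c_m(v,s) = 2·σ*_{s−1/2}(m)·(πmv)^s/(Γ(s)·√m)`. -/
noncomputable def cCoef (m : ℕ) (v s : ℝ) : ℝ :=
  2 * sigmaStar m (s - 1 / 2) * (π * m * v) ^ s / (Real.Gamma s * Real.sqrt m)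

/-- `I_m(v,s) = ∫₁^∞ e^{−2πmvr}·(r²−1)^{s−1} dr`. -/
noncomputable def ICoef (m : ℕ) (v s : ℝ) : ℝ :=
  ∫ r in Ioi (1 : ℝ), Real.exp (-(2 * π * m * v * r)) * (r ^ 2 - 1) ^ (s - 1)

/-- `J_m(v,s) = ∫₁^∞ e^{−2πmvr}·(r²−1)^{s−1}·r dr`. -/
noncomputable def JCoef (m : ℕ) (v s : ℝ) : ℝ :=
  ∫ r in Ioi (1 : ℝ), Real.exp (-(2 * π * m * v * r)) * (r ^ 2 - 1) ^ (s - 1) * r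


open Filter Topology

lemma integrableOn_sub_one_rpow_mul_exp {a p : ℝ} (ha : 0 < a) (hp : -1 < p) :
    IntegrableOn (fun r : ℝ => (r - 1) ^ p * Real.exp (-a * (r - 1))) (Ioi 1) := by
  have h := integrableOn_rpow_mul_exp_neg_mul_rpow hp one_pos ha
  have h' := ((measurePreserving_add_right volume (-1 : ℝ)).integrableOn_comp_preimage
    (measurableEmbedding_addRight (-1 : ℝ))).2 h
  simpa [Function.comp_def, sub_eq_add_neg] using h'

/-- Combination of powers of `u` dominating `r·x^t·|log x|` for `r = u + 1`,
`x = r² − 1`, `|t| ≤ 1/4`. -/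
noncomputable def logPowerBound (u : ℝ) : ℝ :=
  4 * (u ^ (2 : ℝ) + 4 * u ^ (1 : ℝ) + 3 * u ^ (0 : ℝ) + u ^ (1 / 2 : ℝ) + u ^ (-(1 / 2) : ℝ))

lemma integrableOn_logPowerBound {a : ℝ} (ha : 0 < a) :
    IntegrableOn (fun r : ℝ => logPowerBound (r - 1) * Real.exp (-a * (r - 1))) (Ioi 1) := by
  have h (p : ℝ) (hp : -1 < p) := integrableOn_sub_one_rpow_mul_exp ha hp
  have := (((((h 2 (by norm_num)).add ((h 1 (by norm_num)).const_mul 4)).add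
    ((h 0 (by norm_num)).const_mul 3)).add (h (1 / 2) (by norm_num))).add
    (h (-(1 / 2)) (by norm_num))).const_mul 4
  refine IntegrableOn.congr_fun this (fun r _ => ?_) measurableSet_Ioi
  simp only [logPowerBound, Pi.add_apply]
  ring

lemma le_logPowerBound {r : ℝ} (hr : 1 < r) : r ≤ logPowerBound (r - 1) := by
  have hu : 0 < r - 1 := by linarith
  have h1 : 0 < (r - 1) ^ (1 / 2 : ℝ) := by positivity
  have h2 : 0 < (r - 1) ^ (-(1 / 2) : ℝ) := by positivity
  have h3 : 0 < (r - 1) ^ (2 : ℝ) := by positivity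
  simp only [logPowerBound, rpow_one, rpow_zero]
  linarith

lemma rpow_mul_abs_log_le {x t : ℝ} (hx : 0 < x) (ht : |t| ≤ 1 / 4) :
    x ^ t * |Real.log x| ≤ 4 * (x ^ (1 / 2 : ℝ) + 2 + x ^ (-(1 / 2) : ℝ)) := by
  set q := x ^ (1 / 4 : ℝ) with hq
  have hq0 : 0 < q := by positivity
  have hqi : x ^ (-(1 / 4) : ℝ) = q⁻¹ := rpow_neg hx.le _
  have hi0 : 0 < q⁻¹ := by positivity
  have hq2 : x ^ (1 / 2 : ℝ) = q * q := by rw [hq, ← rpow_add hx]; norm_num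
  have hqi2 : x ^ (-(1 / 2) : ℝ) = q⁻¹ * q⁻¹ := by rw [← hqi, ← rpow_add hx]; norm_num
  obtain ⟨ht1, ht2⟩ := abs_le.1 ht
  have hpow : x ^ t ≤ q + q⁻¹ := by
    rcases le_total 1 x with h | h
    · have := rpow_le_rpow_of_exponent_le h ht2
      linarith
    · have := rpow_le_rpow_of_exponent_ge hx h ht1
      linarith
  have hlog : |Real.log x| ≤ 4 * (q + q⁻¹) := by
    have h1 := log_le_rpow_div hx.le (show (0 : ℝ) < 1 / 4 by norm_num)
    have h2 := log_le_rpow_div (inv_pos.2 hx).le (show (0 : ℝ) < 1 / 4 by norm_num)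
    rw [Real.log_inv, inv_rpow hx.le, ← hq] at h2
    rw [← hq] at h1
    rw [abs_le]
    constructor <;> linarith
  calc x ^ t * |Real.log x| ≤ (q + q⁻¹) * (4 * (q + q⁻¹)) := by gcongr
    _ = _ := by rw [hq2, hqi2]; field_simp; ring

lemma rpow_mul_abs_log_mul_le {r t : ℝ} (hr : 1 < r) (ht : |t| ≤ 1 / 4) :
    (r ^ 2 - 1) ^ t * |Real.log (r ^ 2 - 1)| * r ≤ logPowerBound (r - 1) := by
  have hu : 0 < r - 1 := by linarith
  have hx : 0 < r ^ 2 - 1 := by nlinarith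
  have h1 : (r ^ 2 - 1) ^ (1 / 2 : ℝ) ≤ r := by
    rw [← Real.sqrt_eq_rpow]
    exact Real.sqrt_le_iff.2 ⟨by linarith, by linarith⟩
  have h2 : (r ^ 2 - 1) ^ (-(1 / 2) : ℝ) ≤ (r - 1) ^ (-(1 / 2) : ℝ) :=
    rpow_le_rpow_of_nonpos hu (by nlinarith) (by norm_num)
  have h3 : (r - 1) ^ (1 / 2 : ℝ) = (r - 1) * (r - 1) ^ (-(1 / 2) : ℝ) := by
    rw [← rpow_one_add' hu.le (by norm_num)]
    norm_num
  calc _ ≤ 4 * ((r ^ 2 - 1) ^ (1 / 2 : ℝ) + 2 + (r ^ 2 - 1) ^ (-(1 / 2) : ℝ)) * r := by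
        gcongr ?_ * r
        exact rpow_mul_abs_log_le hx ht
    _ ≤ 4 * (r + 2 + (r - 1) ^ (-(1 / 2) : ℝ)) * r := by gcongr
    _ = _ := by
      simp only [logPowerBound, rpow_one, rpow_zero, rpow_two, h3]
      ring

/-- Differentiation under the integral sign in the exponent of `r² − 1`. -/
lemma hasDerivAt_integral_exp_mul_rpow {a : ℝ} (ha : 0 < a) {w : ℝ → ℝ} (hw : Measurable w)
    (hwr : ∀ r, 1 < r → |w r| ≤ r) :
    IntegrableOn (fun r => Real.exp (-(a * r)) * w r) (Ioi 1) ∧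
    IntegrableOn (fun r => Real.exp (-(a * r)) * Real.log (r ^ 2 - 1) * w r) (Ioi 1) ∧
    HasDerivAt (fun s : ℝ =>
        ∫ r in Ioi (1 : ℝ), Real.exp (-(a * r)) * (r ^ 2 - 1) ^ (s - 1) * w r)
      (∫ r in Ioi (1 : ℝ), Real.exp (-(a * r)) * Real.log (r ^ 2 - 1) * w r) 1 := by
  have hexp (r : ℝ) : Real.exp (-(a * r)) ≤ Real.exp (-a * (r - 1)) :=
    Real.exp_le_exp.2 (by linarith)
  have h0 : IntegrableOn (fun r => Real.exp (-(a * r)) * w r) (Ioi 1) := by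
    refine (integrableOn_logPowerBound ha).mono' (by fun_prop) ?_
    filter_upwards [ae_restrict_mem measurableSet_Ioi] with r hr
    rw [norm_mul, Real.norm_eq_abs, Real.norm_eq_abs, Real.abs_exp, mul_comm]
    have := (hwr r hr).trans (le_logPowerBound hr)
    have := hexp r
    have := abs_nonneg (w r)
    gcongr
    linarith
  have key := hasDerivAt_integral_of_dominated_loc_of_deriv_le
    (μ := volume.restrict (Ioi (1 : ℝ))) (x₀ := (1 : ℝ)) (s := Metric.ball 1 (1 / 4))
    (F := fun s r => Real.exp (-(a * r)) * (r ^ 2 - 1) ^ (s - 1) * w r)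
    (F' := fun s r =>
      Real.exp (-(a * r)) * ((r ^ 2 - 1) ^ (s - 1) * Real.log (r ^ 2 - 1)) * w r)
    (Metric.ball_mem_nhds _ (by norm_num))
    (Eventually.of_forall fun s => (by fun_prop))
    (by simpa [IntegrableOn] using h0) (by fun_prop) ?_ (integrableOn_logPowerBound ha) ?_
  · simp only [sub_self, rpow_zero, one_mul] at key
    exact ⟨h0, key⟩
  · filter_upwards [ae_restrict_mem measurableSet_Ioi] with r hr s hs
    have hr' : 1 < r := hr
    have hx : 0 < r ^ 2 - 1 := by nlinarith
    have hs' : |s - 1| ≤ 1 / 4 := by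
      rw [Metric.mem_ball, Real.dist_eq] at hs
      exact hs.le
    simp only [norm_mul, Real.norm_eq_abs, Real.abs_exp, abs_of_pos (rpow_pos_of_pos hx (s - 1))]
    have h1 := rpow_mul_abs_log_mul_le hr' hs'
    have h2 : (r ^ 2 - 1) ^ (s - 1) * |Real.log (r ^ 2 - 1)| * |w r| ≤ logPowerBound (r - 1) := by
      refine le_trans ?_ h1
      gcongr
      exact hwr r hr
    have h3 : 0 ≤ (r ^ 2 - 1) ^ (s - 1) * |Real.log (r ^ 2 - 1)| * |w r| := by positivity
    rw [mul_assoc, mul_comm]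
    have := hexp r
    gcongr
    linarith
  · filter_upwards [ae_restrict_mem measurableSet_Ioi] with r hr s hs
    have hr' : 1 < r := hr
    have hx : 0 < r ^ 2 - 1 := by nlinarith
    have := ((hasDerivAt_id s).sub_const 1).const_rpow hx
    convert! (this.const_mul (Real.exp (-(a * r)))).mul_const (w r) using 1
    simp only [id_eq, mul_one]
    ring

/-- `∫₁^∞ e^{−ar} (1 + a − ar) dr = 0`. -/
lemma integral_exp_mul_one_add_sub {a : ℝ} (ha : 0 < a) :
    ∫ r in Ioi (1 : ℝ), Real.exp (-(a * r)) * (1 + a - a * r) = 0 := by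
  obtain ⟨h1, -, -⟩ := hasDerivAt_integral_exp_mul_rpow ha (w := fun _ => 1) (by fun_prop)
    (fun r hr => by simpa using hr.le)
  obtain ⟨h2, -, -⟩ := hasDerivAt_integral_exp_mul_rpow ha (w := fun r => r) (by fun_prop)
    (fun r hr => (abs_of_pos (by linarith)).le)
  have hd (r : ℝ) : HasDerivAt (fun r => Real.exp (-(a * r)) * (r - 1))
      (Real.exp (-(a * r)) * (1 + a - a * r)) r := by
    have := (((hasDerivAt_id r).const_mul a).neg.exp).mul ((hasDerivAt_id r).sub_const 1)
    convert! this using 1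
    simp
    ring
  have hi : IntegrableOn (fun r => Real.exp (-(a * r)) * (r - 1)) (Ioi 1) :=
    (h2.sub h1).congr_fun (fun r _ => by simp; ring) measurableSet_Ioi
  have hi' : IntegrableOn (fun r => Real.exp (-(a * r)) * (1 + a - a * r)) (Ioi 1) :=
    IntegrableOn.congr_fun ((h1.const_mul (1 + a)).sub (h2.const_mul a)) (fun r _ => by simp; ring)
      measurableSet_Ioi
  have := integral_Ioi_of_hasDerivAt_of_tendsto' (a := 1) (fun r _ => hd r) hi'
    (tendsto_zero_of_hasDerivAt_of_integrableOn_Ioi (fun r _ => hd r) hi' hi)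
  simpa using this

/-- `∫₁^∞ e^{−ar} / (r + 1) dr` as an exponential integral. -/
lemma integral_exp_mul_inv_add_one (a : ℝ) :
    ∫ r in Ioi (1 : ℝ), Real.exp (-(a * r)) * (r + 1)⁻¹ =
      Real.exp a * ∫ t in Ioi (1 : ℝ), Real.exp (-(2 * a * t)) * t⁻¹ := by
  have h1 := integral_comp_mul_left_Ioi (fun x : ℝ => Real.exp (-(a * x)) * x⁻¹) 1
    (two_pos (α := ℝ))
  have h2 := (measurePreserving_add_right volume (1 : ℝ)).setIntegral_preimage_emb
    (measurableEmbedding_addRight (1 : ℝ)) (fun x : ℝ => Real.exp (-(a * x)) * x⁻¹) (Ioi 2)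
  have h3 : (fun x : ℝ => x + 1) ⁻¹' Ioi 2 = Ioi 1 := by
    rw [preimage_add_const_Ioi]; norm_num
  rw [h3] at h2
  rw [mul_one, ← h2, smul_eq_mul] at h1
  have h4 : ∫ t in Ioi (1 : ℝ), Real.exp (-(2 * a * t)) * t⁻¹ =
      2 * ∫ t in Ioi (1 : ℝ), Real.exp (-(a * (2 * t))) * (2 * t)⁻¹ := by
    rw [← integral_const_mul]
    congr 1 with t
    rw [mul_inv, show 2 * a * t = a * (2 * t) by ring]
    ring
  rw [h4, h1, ← mul_assoc, ← mul_assoc, mul_assoc (Real.exp a), mul_inv_cancel₀ two_ne_zero,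
    mul_one, ← integral_const_mul]
  congr 1 with r
  rw [← mul_assoc, ← Real.exp_add]
  ring_nf

/-- Integration by parts for `log (r² − 1)` against `d((r − 1) e^{−ar})`. -/
lemma integral_exp_mul_log_mul {a : ℝ} (ha : 0 < a) :
    ∫ r in Ioi (1 : ℝ), Real.exp (-(a * r)) * Real.log (r ^ 2 - 1) * (1 + a - a * r) =
      -(2 * (Real.exp (-a) / a)) +
        2 * (Real.exp a * ∫ t in Ioi (1 : ℝ), Real.exp (-(2 * a * t)) * t⁻¹) := by
  obtain ⟨h1, h1', -⟩ := hasDerivAt_integral_exp_mul_rpow ha (w := fun _ => 1) (by fun_prop)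
    (fun r hr => by simpa using hr.le)
  obtain ⟨h2, h2', -⟩ := hasDerivAt_integral_exp_mul_rpow ha (w := fun r => r) (by fun_prop)
    (fun r hr => (abs_of_pos (by linarith)).le)
  obtain ⟨h3, -, -⟩ := hasDerivAt_integral_exp_mul_rpow ha (w := fun r => (r + 1)⁻¹)
    (by fun_prop) (fun r hr => by
      rw [abs_of_pos (by positivity)]
      exact (inv_le_one_of_one_le₀ (by linarith)).trans hr.le)
  set L : ℝ → ℝ := fun r => Real.exp (-(a * r)) * Real.log (r ^ 2 - 1) * (1 + a - a * r)
  set R : ℝ → ℝ := fun r => 2 * Real.exp (-(a * r)) - 2 * (Real.exp (-(a * r)) * (r + 1)⁻¹)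
  set G : ℝ → ℝ := fun r => Real.exp (-(a * r)) *
    ((r - 1) * Real.log (r - 1) + (r - 1) * Real.log (r + 1))
  have h1 : IntegrableOn (fun r => Real.exp (-(a * r))) (Ioi 1) := by simpa using h1
  have hG (r : ℝ) (hr : 1 < r) :
      G r = Real.exp (-(a * r)) * Real.log (r ^ 2 - 1) * (r - 1) := by
    simp only [G]
    rw [show r ^ 2 - 1 = (r - 1) * (r + 1) by ring,
      Real.log_mul (by linarith) (by linarith)]
    ring
  have hL : IntegrableOn L (Ioi 1) :=
    IntegrableOn.congr_fun ((h1'.const_mul (1 + a)).sub (h2'.const_mul a))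
      (fun r _ => by simp [L]; ring)
      measurableSet_Ioi
  have hR : IntegrableOn R (Ioi 1) := (h1.const_mul 2).sub (h3.const_mul 2)
  have hGi : IntegrableOn G (Ioi 1) :=
    (h2'.sub h1').congr_fun (fun r hr => by rw [hG r hr]; simp; ring) measurableSet_Ioi
  have hd (r : ℝ) (hr : r ∈ Ioi (1 : ℝ)) : HasDerivAt G (L r + R r) r := by
    have hr' : 1 < r := hr
    have hm : r - 1 ≠ 0 := by linarith
    have hp : r + 1 ≠ 0 := by linarith
    have e := ((hasDerivAt_id r).const_mul a).neg.exp
    have m := (hasDerivAt_id r).sub_const 1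
    have p := (hasDerivAt_id r).add_const 1
    have := e.mul ((m.mul (m.log hm)).add (m.mul (p.log hp)))
    convert! this using 1
    simp only [L, R]
    rw [show r ^ 2 - 1 = (r - 1) * (r + 1) by ring, Real.log_mul hm hp]
    simp
    field_simp
    ring
  have hc : ContinuousWithinAt G (Ici 1) 1 := by
    have h : Continuous fun r : ℝ => (r - 1) * Real.log (r - 1) :=
      Real.continuous_mul_log.comp (continuous_id.sub continuous_const)
    have h' : ContinuousAt (fun r : ℝ => Real.log (r + 1)) 1 :=
      ContinuousAt.log (by fun_prop) (by norm_num)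
    refine ContinuousAt.continuousWithinAt ?_
    have := h.continuousAt (x := 1)
    fun_prop
  have hft := integral_Ioi_of_hasDerivAt_of_tendsto hc hd (hL.add hR)
    (tendsto_zero_of_hasDerivAt_of_integrableOn_Ioi hd (hL.add hR) hGi)
  have hRv : ∫ r in Ioi (1 : ℝ), R r = 2 * (Real.exp (-a) / a) -
      2 * (Real.exp a * ∫ t in Ioi (1 : ℝ), Real.exp (-(2 * a * t)) * t⁻¹) := by
    have he : ∫ r in Ioi (1 : ℝ), Real.exp (-(a * r)) = Real.exp (-a) / a := by
      simpa using integral_exp_mul_Ioi (neg_lt_zero.2 ha) 1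
    rw [integral_sub (h1.const_mul 2) (h3.const_mul 2), integral_const_mul, integral_const_mul,
      he, integral_exp_mul_inv_add_one]
  rw [integral_add hL hR, hRv] at hft
  have : G 1 = 0 := by simp [G]
  linarith

lemma sigmaStar_half {n : ℕ} (hn : 1 ≤ n) :
    sigmaStar n (1 / 2) = (∑ d ∈ n.divisors, (d : ℝ)) / Real.sqrt n := by
  have hn0 : (0 : ℝ) < n := by exact_mod_cast hn
  have hsum : (∑ d ∈ n.divisors, (d : ℝ)) = n * ∑ d ∈ n.divisors, (d : ℝ)⁻¹ := by
    rw [← Nat.sum_div_divisors n (fun d => (d : ℝ)), Finset.mul_sum]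
    refine Finset.sum_congr rfl fun d hd => ?_
    rw [Nat.cast_div (Nat.dvd_of_mem_divisors hd)
      (by exact_mod_cast (Nat.pos_of_mem_divisors hd).ne'), div_eq_mul_inv]
  have hneg : ∑ d ∈ n.divisors, (d : ℝ) ^ (-(2 * (1 / 2)) : ℝ) = ∑ d ∈ n.divisors, (d : ℝ)⁻¹ := by
    norm_num [rpow_neg_one]
  rw [sigmaStar, hneg, hsum, ← Real.sqrt_eq_rpow, eq_div_iff (by positivity)]
  nth_rw 3 [← Real.mul_self_sqrt hn0.le]
  ring

lemma cCoef_one {n : ℕ} (hn : 1 ≤ n) (v : ℝ) :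
    cCoef n v 1 = 2 * π * v * ∑ d ∈ n.divisors, (d : ℝ) := by
  have hn0 : (0 : ℝ) < n := by exact_mod_cast hn
  rw [cCoef, show (1 : ℝ) - 1 / 2 = 1 / 2 by norm_num, sigmaStar_half hn, rpow_one, Real.Gamma_one,
    one_mul]
  field_simp
  rw [Real.sq_sqrt hn0.le]

lemma differentiableAt_cCoef_one {n : ℕ} (hn : 1 ≤ n) {v : ℝ} (hv : 0 < v) :
    DifferentiableAt ℝ (cCoef n v) 1 := by
  have hn0 : (0 : ℝ) < n := by exact_mod_cast hn
  have hG : DifferentiableAt ℝ Real.Gamma 1 :=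
    Real.differentiableAt_Gamma fun m => by
      have : (0 : ℝ) ≤ m := m.cast_nonneg
      linarith
  have hpow {x : ℝ} (hx : 0 < x) {f : ℝ → ℝ} (hf : DifferentiableAt ℝ f 1) :
      DifferentiableAt ℝ (fun s => x ^ f s) 1 := (hf.hasDerivAt.const_rpow hx).differentiableAt
  have hσ : DifferentiableAt ℝ (fun s : ℝ => sigmaStar n (s - 1 / 2)) 1 := by
    refine (hpow hn0 (by fun_prop)).mul (DifferentiableAt.fun_sum fun d hd => ?_)
    exact hpow (by exact_mod_cast Nat.pos_of_mem_divisors hd) (by fun_prop)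
  refine (((hσ.const_mul 2).mul (hpow (by positivity) differentiableAt_id)).div
    (hG.mul_const _) ?_)
  rw [Real.Gamma_one]
  positivity

/-- The Fourier coefficient of `E₂'(τ,1)` for negative index `m = −n`:
`φ'(1) = e^{2πnv}·σ(n)·( e^{−4πnv}/(4πnv) − ∫₁^∞ e^{−4πnvt}·t⁻¹ dt )`. -/
theorem fourier_coeff_E2_deriv_neg (n : ℕ) (hn : 1 ≤ n) (v : ℝ) (hv : 0 < v) :
    HasDerivAt (fun s : ℝ => -(1 / (4 * π)) *
        (s / v * cCoef n v s * ICoef n v s +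
          2 * π * n * cCoef n v s * (ICoef n v s - JCoef n v s)))
      (Real.exp (2 * π * n * v) * (∑ d ∈ n.divisors, (d : ℝ)) *
        (Real.exp (-(4 * π * n * v)) / (4 * π * n * v) -
          ∫ t in Ioi (1 : ℝ), Real.exp (-(4 * π * n * v * t)) * t⁻¹)) 1 := by
  have hn0 : (0 : ℝ) < n := by exact_mod_cast hn
  set a : ℝ := 2 * π * n * v with ha'
  have ha : 0 < a := by positivity
  obtain ⟨hI0, hI1, hI⟩ := hasDerivAt_integral_exp_mul_rpow ha (w := fun _ => 1) (by fun_prop)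
    (fun r hr => by simpa using hr.le)
  obtain ⟨hJ0, hJ1, hJ⟩ := hasDerivAt_integral_exp_mul_rpow ha (w := fun r => r) (by fun_prop)
    (fun r hr => (abs_of_pos (by linarith)).le)
  simp only [mul_one] at hI0 hI1 hI
  set I' := ∫ r in Ioi (1 : ℝ), Real.exp (-(a * r)) * Real.log (r ^ 2 - 1)
  set J' := ∫ r in Ioi (1 : ℝ), Real.exp (-(a * r)) * Real.log (r ^ 2 - 1) * r
  have hI : HasDerivAt (ICoef n v) I' 1 := hI
  have hJ : HasDerivAt (JCoef n v) J' 1 := hJ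
  have hI1v : ICoef n v 1 = Real.exp (-a) / a := by
    have : ∫ r in Ioi (1 : ℝ), Real.exp (-(a * r)) = Real.exp (-a) / a := by
      simpa using integral_exp_mul_Ioi (neg_lt_zero.2 ha) 1
    simpa [ICoef, ← ha'] using this
  have hJ1v : JCoef n v 1 = ∫ r in Ioi (1 : ℝ), Real.exp (-(a * r)) * r := by
    simp [JCoef, ← ha']
  have hzero : ICoef n v 1 + a * (ICoef n v 1 - JCoef n v 1) = 0 := by
    have hd : IntegrableOn (fun r => a * (Real.exp (-(a * r)) - Real.exp (-(a * r)) * r)) (Ioi 1) :=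
      (hI0.sub hJ0).const_mul a
    rw [← integral_exp_mul_one_add_sub ha, hJ1v, show ICoef n v 1 =
      ∫ r in Ioi (1 : ℝ), Real.exp (-(a * r)) by simp [ICoef, ← ha'], ← integral_sub hI0 hJ0,
      ← integral_const_mul, ← integral_add hI0 hd]
    congr 1 with r
    ring
  have hlog : I' + a * (I' - J') = -(2 * (Real.exp (-a) / a)) +
      2 * (Real.exp a * ∫ t in Ioi (1 : ℝ), Real.exp (-(2 * a * t)) * t⁻¹) := by
    have hd : IntegrableOn (fun r => a * (Real.exp (-(a * r)) * Real.log (r ^ 2 - 1) -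
        Real.exp (-(a * r)) * Real.log (r ^ 2 - 1) * r)) (Ioi 1) :=
      (hI1.sub hJ1).const_mul a
    rw [← integral_exp_mul_log_mul ha, ← integral_sub hI1 hJ1,
      ← integral_const_mul, ← integral_add hI1 hd]
    congr 1 with r
    ring
  have hc := (differentiableAt_cCoef_one hn hv).hasDerivAt
  have hF : HasDerivAt (fun s => s * ICoef n v s + a * (ICoef n v s - JCoef n v s))
      (ICoef n v 1 + (I' + a * (I' - J'))) 1 := by
    convert! ((hasDerivAt_id (1 : ℝ)).mul hI).add ((hI.sub hJ).const_mul a) using 1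
    simp
    ring
  have hE : Real.exp (-(4 * π * n * v)) = Real.exp (-a) * Real.exp (-a) := by
    rw [← Real.exp_add]
    congr 1
    rw [ha']
    ring
  have hE' : Real.exp a * Real.exp (-a) = 1 := by rw [← Real.exp_add]; simp
  convert! (hc.mul hF).const_mul (-(1 / (4 * π * v))) using 1
  · ext s
    simp only [Pi.mul_apply]
    rw [ha']
    field_simp
  · rw [hlog, one_mul, hzero, hI1v, cCoef_one hn, hE,
      show 4 * π * n * v = 2 * a by rw [ha']; ring]
    have : Real.exp (-a) = (Real.exp a)⁻¹ := Real.exp_neg a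
    rw [this]
    field_simp
    ring
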